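/- Let A be a commutative ring, B a commutative A-algebra, and G a finite group acting on B by A-algebra automorphisms. Suppose the A-algebra map h : B ⊗_A B → (G → B), determined on pure tensors by h(b ⊗ b')(g) = b · (g • b') (where the target carries the pointwise ring structure), is bijective. Then the module of Kähler differentials Ω[B⁄A] is trivial (a subsingleton). -/

import Mathlib

open scoped TensorProduct

/-- If `G` is a finite group acting on the commutative `A`-algebra `B` by `A`-algebra
automorphisms and the canonical map `B ⊗[A] B → (G → B)`, `b ⊗ b' ↦ (g ↦ b * (g • b'))`,
is bijective (the unramifiedness condition of a `G`-Galois extension), then the module of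
Kähler differentials `Ω[B⁄A]` is trivial. -/
theorem kaehlerDifferential_subsingleton_of_galois
    {A B G : Type*} [CommRing A] [CommRing B] [Algebra A B]
    [Group G] [Finite G] (ρ : G →* (B ≃ₐ[A] B))
    (h : B ⊗[A] B →ₐ[A] (G → B))
    (hh : ∀ (b b' : B) (g : G), h (b ⊗ₜ b') g = b * ρ g b')
    (hbij : Function.Bijective h) :
    Subsingleton (KaehlerDifferential A B) := by
  classical
  have h_one (x : B ⊗[A] B) : h x 1 = Algebra.TensorProduct.lmul' A x := by
    induction x with
    | zero => simp
    | tmul b b' => simp [hh]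
    | add x y hx hy => simp [hx, hy]
  have mem_iff (x : B ⊗[A] B) : x ∈ KaehlerDifferential.ideal A B ↔ h x 1 = 0 := by
    rw [RingHom.mem_ker, h_one]
  -- The ideal of the diagonal is generated by the idempotent supported off the identity.
  obtain ⟨e, he⟩ := hbij.surjective (fun g ↦ if g = 1 then 0 else 1)
  have he_mem : e ∈ KaehlerDifferential.ideal A B := by simp [mem_iff, he]
  refine (Ideal.cotangent_subsingleton_iff (KaehlerDifferential.ideal A B)).mpr
    (le_antisymm Ideal.mul_le_right fun x hx ↦ ?_)
  have hxe : x * e = x := by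
    apply hbij.injective
    ext g
    by_cases hg : g = 1
    · subst hg
      simp [he, (mem_iff x).mp hx]
    · simp [he, hg]
  exact hxe ▸ Ideal.mul_mem_mul hx he_mem
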